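/- (Ramanujan's beta integral from the lost notebook) Let τ ∈ ℍ, q = exp(2πiτ), q̃ = exp(-2πi/τ), and let c, d ∈ ℂ with |c|, |d| < |q̃|^{-1/2}. Then ∫_{-∞}^∞ q^{x²/2} / [(-q̃^{1/2} c e^{-2πix}; q̃)_∞ (-q̃^{1/2} d e^{2πix}; q̃)_∞] dx = (1/√(-iτ)) · (q̃c; q̃)_∞ (q̃d; q̃)_∞ / (q̃cd; q̃)_∞. -/

import Mathlib

open scoped Real

/-- The infinite q-Pochhammer symbol `(a;q)_∞ = ∏_{j=0}^∞ (1 - a q^j)`. -/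
noncomputable def qPochInf (a q : ℂ) : ℂ := ∏' n : ℕ, (1 - a * q ^ n)

open Filter Topology Finset

theorem multipliable_one_sub_mul_pow (a : ℂ) {q : ℂ} (hq : ‖q‖ < 1) :
    Multipliable fun n : ℕ ↦ 1 - a * q ^ n := by
  simp_rw [sub_eq_add_neg]
  apply multipliable_one_add_of_summable
  simpa using (summable_geometric_of_lt_one (norm_nonneg _) hq).mul_left ‖a‖

theorem tendsto_qPochInf (a : ℂ) {q : ℂ} (hq : ‖q‖ < 1) :
    Tendsto (fun n ↦ ∏ j ∈ range n, (1 - a * q ^ j)) atTop (𝓝 (qPochInf a q)) :=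
  (multipliable_one_sub_mul_pow a hq).tendsto_prod_tprod_nat

theorem qPochInf_eq_mul (a : ℂ) {q : ℂ} (hq : ‖q‖ < 1) :
    qPochInf a q = (1 - a) * qPochInf (a * q) q := by
  have h : Multipliable fun n : ℕ ↦ 1 - a * q ^ (n + 1) := by
    simpa [pow_succ', mul_assoc] using multipliable_one_sub_mul_pow (a * q) hq
  have h0 : qPochInf a q = (1 - a * q ^ 0) * ∏' n : ℕ, (1 - a * q ^ (n + 1)) :=
    tprod_eq_zero_mul' (f := fun n : ℕ ↦ 1 - a * q ^ n) h
  rw [h0, pow_zero, mul_one, qPochInf]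
  simp_rw [pow_succ', mul_assoc]

theorem qPochInf_zero (q : ℂ) : qPochInf 0 q = 1 := by simp [qPochInf]

theorem one_sub_pow_succ_ne_zero {q : ℂ} (hq : ‖q‖ < 1) (n : ℕ) : 1 - q ^ (n + 1) ≠ 0 := by
  intro h
  have h1 : ‖q‖ ^ (n + 1) = 1 := by rw [← norm_pow, ← sub_eq_zero.mp h, norm_one]
  exact (pow_lt_one₀ (norm_nonneg _) hq n.succ_ne_zero).ne h1

/-- The Taylor coefficients of `x ↦ (bx;q)_∞ / (dx;q)_∞`. -/
noncomputable def qBinomCoeff (d b q : ℂ) (n : ℕ) : ℂ :=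
  ∏ j ∈ range n, ((d - b * q ^ j) / (1 - q ^ (j + 1)))

theorem qBinomCoeff_succ (d b q : ℂ) (n : ℕ) :
    qBinomCoeff d b q (n + 1) = qBinomCoeff d b q n * ((d - b * q ^ n) / (1 - q ^ (n + 1))) :=
  prod_range_succ _ _

theorem summable_norm_qBinomCoeff {d x q : ℂ} (b : ℂ) (hq : ‖q‖ < 1) (hx : ‖d * x‖ < 1) :
    Summable fun n ↦ ‖qBinomCoeff d b q n * x ^ n‖ := by
  obtain ⟨r, hr, hr1⟩ := exists_between hx
  have hqt := tendsto_pow_atTop_nhds_zero_of_norm_lt_one hq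
  have ht : Tendsto (fun n : ℕ ↦ ‖(d - b * q ^ n) / (1 - q ^ (n + 1)) * x‖) atTop
      (𝓝 ‖(d - b * 0) / (1 - 0) * x‖) :=
    ((((hqt.const_mul b).const_sub d).div
      ((hqt.comp (tendsto_add_atTop_nat 1)).const_sub 1) (by simp)).mul_const x).norm
  apply summable_of_ratio_norm_eventually_le hr1
  filter_upwards [ht.eventually_lt_const (u := r) (by simpa using hr)] with n hn
  simp only [norm_norm]
  calc ‖qBinomCoeff d b q (n + 1) * x ^ (n + 1)‖
      = ‖(d - b * q ^ n) / (1 - q ^ (n + 1)) * x‖ * ‖qBinomCoeff d b q n * x ^ n‖ := by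
        rw [← norm_mul, qBinomCoeff_succ, pow_succ]; ring_nf
    _ ≤ r * ‖qBinomCoeff d b q n * x ^ n‖ := by gcongr

theorem one_sub_mul_tsum_qBinomCoeff {d x q : ℂ} (b : ℂ) (hq : ‖q‖ < 1) (hx : ‖d * x‖ < 1) :
    (1 - d * x) * ∑' n, qBinomCoeff d b q n * x ^ n =
      (1 - b * x) * ∑' n, qBinomCoeff d b q n * (x * q) ^ n := by
  have hxq : ‖d * (x * q)‖ < 1 := by
    rw [← mul_assoc, norm_mul]
    exact mul_lt_one_of_nonneg_of_lt_one_left (norm_nonneg _) hx hq.le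
  have h1 := (summable_norm_qBinomCoeff b hq hx).of_norm
  have h2 := (summable_norm_qBinomCoeff b hq hxq).of_norm
  have h3 := (h1.hasSum.sub h2.hasSum).tsum_eq
  rw [(h1.sub h2).tsum_eq_zero_add] at h3
  simp only [pow_zero, sub_self, zero_add] at h3
  have h4 := ((h1.hasSum.mul_left (d * x)).sub (h2.hasSum.mul_left (b * x))).tsum_eq
  have h5 (n : ℕ) : qBinomCoeff d b q (n + 1) * x ^ (n + 1) -
      qBinomCoeff d b q (n + 1) * (x * q) ^ (n + 1) =
      d * x * (qBinomCoeff d b q n * x ^ n) - b * x * (qBinomCoeff d b q n * (x * q) ^ n) := by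
    have := one_sub_pow_succ_ne_zero hq n
    rw [qBinomCoeff_succ]
    field_simp
    ring
  rw [tsum_congr h5, h4] at h3
  linear_combination -h3

/-- The `q`-binomial theorem, in a homogeneous form which is also valid for `d = 0`. -/
theorem qPochInf_mul_tsum_qBinomCoeff {d x q : ℂ} (b : ℂ) (hq : ‖q‖ < 1) (hx : ‖d * x‖ < 1) :
    qPochInf (d * x) q * ∑' n, qBinomCoeff d b q n * x ^ n = qPochInf (b * x) q := by
  have hle (N : ℕ) : ‖q ^ N‖ ≤ 1 := by
    rw [norm_pow]; exact pow_le_one₀ (norm_nonneg _) hq.le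
  have hN (N : ℕ) : (∏ j ∈ range N, (1 - d * x * q ^ j)) * ∑' n, qBinomCoeff d b q n * x ^ n =
      (∏ j ∈ range N, (1 - b * x * q ^ j)) * ∑' n, qBinomCoeff d b q n * (x * q ^ N) ^ n := by
    induction N with
    | zero => simp
    | succ N ih =>
      have hxN : ‖d * (x * q ^ N)‖ < 1 := by
        rw [← mul_assoc, norm_mul]
        exact mul_lt_one_of_nonneg_of_lt_one_left (norm_nonneg _) hx (hle N)
      have h := one_sub_mul_tsum_qBinomCoeff b hq hxN
      rw [prod_range_succ, prod_range_succ, mul_right_comm, ih, pow_succ, ← mul_assoc x]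
      linear_combination (∏ j ∈ range N, (1 - b * x * q ^ j)) * h
  have hlim : Tendsto (fun N : ℕ ↦ ∑' n, qBinomCoeff d b q n * (x * q ^ N) ^ n) atTop (𝓝 1) := by
    have h := tendsto_tsum_of_dominated_convergence
      (f := fun N n : ℕ ↦ qBinomCoeff d b q n * (x * q ^ N) ^ n)
      (g := fun n : ℕ ↦ qBinomCoeff d b q n * (x * 0) ^ n) (𝓕 := atTop)
      (summable_norm_qBinomCoeff b hq hx)
      (fun n ↦ (((tendsto_pow_atTop_nhds_zero_of_norm_lt_one hq).const_mul x).pow n).const_mul _)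
      (.of_forall fun N n ↦ by
        rw [mul_pow, ← mul_assoc, norm_mul _ ((q ^ N) ^ n), norm_pow (q ^ N)]
        exact mul_le_of_le_one_right (norm_nonneg _) (pow_le_one₀ (norm_nonneg _) (hle N)))
    rwa [tsum_eq_single 0 (fun n hn ↦ by simp [hn]), pow_zero, mul_one,
      show qBinomCoeff d b q 0 = 1 from prod_range_zero _] at h
  have hL := (tendsto_qPochInf (d * x) hq).mul_const (∑' n, qBinomCoeff d b q n * x ^ n)
  simp_rw [hN] at hL
  simpa using tendsto_nhds_unique hL ((tendsto_qPochInf (b * x) hq).mul hlim)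

theorem qPochInf_ne_zero {x q : ℂ} (hq : ‖q‖ < 1) (hx : ‖x‖ < 1) : qPochInf x q ≠ 0 := by
  have h := qPochInf_mul_tsum_qBinomCoeff (d := 1) (x := x) 0 hq (by simpa using hx)
  rw [one_mul, zero_mul, qPochInf_zero] at h
  exact left_ne_zero_of_mul_eq_one h

theorem inv_qPochInf_eq_tsum {x q : ℂ} (hq : ‖q‖ < 1) (hx : ‖x‖ < 1) :
    (qPochInf x q)⁻¹ = ∑' n, qBinomCoeff 1 0 q n * x ^ n := by
  have h := qPochInf_mul_tsum_qBinomCoeff (d := 1) (x := x) 0 hq (by simpa using hx)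
  rw [one_mul, zero_mul, qPochInf_zero] at h
  exact inv_eq_of_mul_eq_one_right h

theorem tsum_qBinomCoeff_zero_one (x : ℂ) {q : ℂ} (hq : ‖q‖ < 1) :
    ∑' n, qBinomCoeff 0 1 q n * x ^ n = qPochInf x q := by
  simpa [qPochInf_zero] using qPochInf_mul_tsum_qBinomCoeff (d := 0) (x := x) 1 hq (by simp)

theorem qBinomCoeff_one_zero_mul_pow_sq (s : ℂ) (n : ℕ) :
    qBinomCoeff 1 0 (s ^ 2) n * (-1) ^ n * s ^ n ^ 2 = qBinomCoeff 0 1 (s ^ 2) n * s ^ n := by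
  induction n with
  | zero => simp [qBinomCoeff]
  | succ n ih =>
    simp only [qBinomCoeff_succ, zero_mul, one_mul, sub_zero, zero_sub]
    rw [show (n + 1) ^ 2 = n ^ 2 + (2 * n + 1) by ring]
    linear_combination ih * (1 / (1 - (s ^ 2) ^ (n + 1))) * (-(s ^ (2 * n + 1)))

theorem qPochInf_mul_inv_pow (d : ℂ) {q : ℂ} (hq : ‖q‖ < 1) (hq0 : q ≠ 0) (m : ℕ) :
    qBinomCoeff 0 1 q m * qPochInf (d * q * (q ^ m)⁻¹) q =
      qBinomCoeff d 1 q m * qPochInf (d * q) q := by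
  induction m with
  | zero => simp [qBinomCoeff]
  | succ m ih =>
    have h : d * q * (q ^ (m + 1))⁻¹ = d * (q ^ m)⁻¹ := by
      field_simp
      ring
    rw [h, qPochInf_eq_mul _ hq, mul_right_comm d, qBinomCoeff_succ, qBinomCoeff_succ]
    have hqm : q ^ m * (q ^ m)⁻¹ = 1 := mul_inv_cancel₀ (pow_ne_zero _ hq0)
    linear_combination ((d - q ^ m) / (1 - q ^ (m + 1))) * ih +
      d / (1 - q ^ (m + 1)) * (qBinomCoeff 0 1 q m * qPochInf (d * q * (q ^ m)⁻¹) q) * hqm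

/-- The inner sum of the double series obtained by termwise integration, with base `s ^ 2`. -/
theorem tsum_qBinomCoeff_mul_gaussian_right (c d : ℂ) {s : ℂ} (hs : ‖s ^ 2‖ < 1) (hs0 : s ≠ 0)
    (m : ℕ) :
    ∑' n : ℕ, qBinomCoeff 1 0 (s ^ 2) m * (-s * c) ^ m *
        (qBinomCoeff 1 0 (s ^ 2) n * (-s * d) ^ n) * s ^ ((n - m : ℤ) ^ 2) =
      qPochInf (s ^ 2 * d) (s ^ 2) * (qBinomCoeff d 1 (s ^ 2) m * (s ^ 2 * c) ^ m) := by
  have hterm (n : ℕ) : qBinomCoeff 1 0 (s ^ 2) m * (-s * c) ^ m *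
      (qBinomCoeff 1 0 (s ^ 2) n * (-s * d) ^ n) * s ^ ((n - m : ℤ) ^ 2) =
      qBinomCoeff 0 1 (s ^ 2) m * (s ^ 2 * c) ^ m *
        (qBinomCoeff 0 1 (s ^ 2) n * (d * s ^ 2 * ((s ^ 2) ^ m)⁻¹) ^ n) := by
    have he : s ^ ((n - m : ℤ) ^ 2) = s ^ n ^ 2 * s ^ m ^ 2 * (((s ^ 2) ^ m)⁻¹) ^ n := by
      rw [show ((n - m : ℤ) ^ 2) = ((n ^ 2 + m ^ 2 : ℕ) : ℤ) - ((2 * m * n : ℕ) : ℤ) by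
        push_cast; ring, zpow_sub₀ hs0, zpow_natCast, zpow_natCast, pow_add, pow_mul, pow_mul,
        inv_pow, div_eq_mul_inv]
    have h1 := qBinomCoeff_one_zero_mul_pow_sq s m
    have h2 := qBinomCoeff_one_zero_mul_pow_sq s n
    rw [he, neg_mul, neg_mul, neg_pow, neg_pow (s * d), mul_pow s c, mul_pow s d, mul_pow,
      mul_pow (d * s ^ 2), mul_pow d, ← pow_mul s 2 m, ← pow_mul s 2 n, mul_comm 2 m, mul_comm 2 n,
      pow_mul s m, pow_mul s n]
    linear_combination s ^ m * c ^ m * (qBinomCoeff 1 0 (s ^ 2) n * (-1) ^ n * s ^ n ^ 2) * s ^ n *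
      d ^ n * (((s ^ m) ^ 2)⁻¹) ^ n * h1 + s ^ m * c ^ m * (qBinomCoeff 0 1 (s ^ 2) m * s ^ m) *
      s ^ n * d ^ n * (((s ^ m) ^ 2)⁻¹) ^ n * h2
  rw [tsum_congr hterm, tsum_mul_left, tsum_qBinomCoeff_zero_one _ hs, mul_comm (s ^ 2) d]
  linear_combination (s ^ 2 * c) ^ m * qPochInf_mul_inv_pow d hs (pow_ne_zero 2 hs0) m

theorem integral_gaussian_mul_cexp {τ : ℂ} (hτ : 0 < τ.im) (k : ℤ) :
    ∫ x : ℝ, Complex.exp (π * Complex.I * τ * x ^ 2 + 2 * π * Complex.I * k * x + 0) =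
      ((-Complex.I * τ) ^ (1 / 2 : ℂ))⁻¹ * Complex.exp (-(π * Complex.I) / τ) ^ (k ^ 2) := by
  have hτ0 : τ ≠ 0 := fun h ↦ by simp [h] at hτ
  have hre : (π * Complex.I * τ).re < 0 := by simpa using mul_pos Real.pi_pos hτ
  have harg : (-Complex.I * τ).arg ≠ π := fun h ↦ by
    have := (Complex.arg_eq_pi_iff.mp h).1
    simp at this
    linarith
  have hπ : (π : ℂ) ≠ 0 := Complex.ofReal_ne_zero.mpr Real.pi_ne_zero
  rw [integral_cexp_quadratic hre, ← Complex.inv_cpow _ _ harg, ← Complex.exp_int_mul]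
  congr 2
  · field_simp
  · push_cast
    field_simp
    ring

/-- Termwise integration of an absolutely convergent double Fourier series against a Gaussian. -/
theorem hasSum_integral_gaussian_mul_fourier {τ : ℂ} (hτ : 0 < τ.im) {w : ℕ × ℕ → ℂ}
    (hw : Summable fun p ↦ ‖w p‖) :
    HasSum (fun p : ℕ × ℕ ↦ ((-Complex.I * τ) ^ (1 / 2 : ℂ))⁻¹ *
        (w p * Complex.exp (-(π * Complex.I) / τ) ^ ((p.2 - p.1 : ℤ) ^ 2)))
      (∫ x : ℝ, ∑' p, w p * Complex.exp (π * Complex.I * τ * x ^ 2 +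
        2 * π * Complex.I * ((p.2 - p.1 : ℤ) : ℂ) * x + 0)) := by
  let F : ℕ × ℕ → ℝ → ℂ := fun p x ↦ w p * Complex.exp
    (π * Complex.I * τ * x ^ 2 + 2 * π * Complex.I * ((p.2 - p.1 : ℤ) : ℂ) * x + 0)
  have hre : (π * Complex.I * τ).re < 0 := by simpa using mul_pos Real.pi_pos hτ
  have hFint (p : ℕ × ℕ) : MeasureTheory.Integrable (F p) :=
    (integrable_cexp_quadratic' hre _ _).const_mul _
  have hFnorm (p : ℕ × ℕ) (x : ℝ) :
      ‖F p x‖ = ‖w p‖ * ‖Complex.exp (π * Complex.I * τ * x ^ 2)‖ := by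
    rw [norm_mul, add_zero, Complex.exp_add, norm_mul (Complex.exp _),
      show 2 * (π : ℂ) * Complex.I * ((p.2 - p.1 : ℤ) : ℂ) * x =
        ((2 * π * (p.2 - p.1 : ℤ) * x : ℝ) : ℂ) * Complex.I by push_cast; ring,
      Complex.norm_exp_ofReal_mul_I, mul_one]
  have hFsum : Summable fun p ↦ ∫ x, ‖F p x‖ := by
    simp_rw [hFnorm, MeasureTheory.integral_const_mul]
    exact hw.mul_right _
  have hF := MeasureTheory.hasSum_integral_of_summable_integral_norm hFint hFsum
  have hFval (p : ℕ × ℕ) : ∫ x, F p x =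
      ((-Complex.I * τ) ^ (1 / 2 : ℂ))⁻¹ *
        (w p * Complex.exp (-(π * Complex.I) / τ) ^ ((p.2 - p.1 : ℤ) ^ 2)) := by
    rw [MeasureTheory.integral_const_mul, integral_gaussian_mul_cexp hτ]
    ring
  simpa only [hFval] using hF

/-- Ramanujan's beta integral from the lost notebook: for `τ ∈ ℍ`,
`q = exp(2πiτ)`, `q̃ = exp(-2πi/τ)` and `|c|,|d| < |q̃|^{-1/2}`,
`∫_{-∞}^∞ q^{x²/2} / ((-q̃^{1/2}ce^{-2πix};q̃)_∞ (-q̃^{1/2}de^{2πix};q̃)_∞) dx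
= (1/√(-iτ)) (q̃c;q̃)_∞ (q̃d;q̃)_∞ / (q̃cd;q̃)_∞`. -/
theorem ramanujan_lost_notebook_integral (τ c d : ℂ) (hτ : 0 < τ.im)
    (q qt : ℂ) (hq : q = Complex.exp (2 * (π : ℂ) * Complex.I * τ))
    (hqt : qt = Complex.exp (-(2 * (π : ℂ) * Complex.I) / τ))
    (hc : ‖c‖ < ‖qt‖ ^ (-(1 / 2) : ℝ)) (hd : ‖d‖ < ‖qt‖ ^ (-(1 / 2) : ℝ)) :
    (∫ x : ℝ,
      Complex.exp ((π : ℂ) * Complex.I * τ * (x : ℂ) ^ 2) /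
      (qPochInf (-(Complex.exp (-((π : ℂ) * Complex.I) / τ)) * c *
          Complex.exp (-(2 * (π : ℂ) * Complex.I * (x : ℂ)))) qt *
        qPochInf (-(Complex.exp (-((π : ℂ) * Complex.I) / τ)) * d *
          Complex.exp (2 * (π : ℂ) * Complex.I * (x : ℂ))) qt)) =
    ((-Complex.I * τ) ^ (1 / 2 : ℂ))⁻¹ *
      (qPochInf (qt * c) qt * qPochInf (qt * d) qt / qPochInf (qt * c * d) qt) := by
  subst hq
  set s := Complex.exp (-((π : ℂ) * Complex.I) / τ) with hs
  have hs0 : s ≠ 0 := Complex.exp_ne_zero _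
  have hqs : qt = s ^ 2 := by
    rw [hqt, hs, ← Complex.exp_nat_mul]
    push_cast
    ring_nf
  have hτ0 : τ ≠ 0 := fun h ↦ by simp [h] at hτ
  have hs1 : ‖s‖ < 1 := by
    rw [hs, Complex.norm_exp, Real.exp_lt_one_iff, Complex.div_re]
    have := Complex.normSq_pos.mpr hτ0
    have h : 0 < π * τ.im / Complex.normSq τ := by positivity
    simpa [neg_div] using h
  have hnorm : ‖qt‖ ^ (-(1 / 2) : ℝ) = ‖s‖⁻¹ := by
    rw [hqs, norm_pow, ← Real.rpow_natCast, ← Real.rpow_mul (norm_nonneg _)]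
    norm_num [Real.rpow_neg_one]
  clear hqt
  subst hqs
  have hsp : 0 < ‖s‖ := norm_pos_iff.mpr hs0
  have hq1 : ‖s ^ 2‖ < 1 := by
    rw [norm_pow]
    exact pow_lt_one₀ (norm_nonneg _) hs1 two_ne_zero
  have hsc : ‖-s * c‖ < 1 := by
    rwa [neg_mul, norm_neg, norm_mul, mul_comm, ← lt_div_iff₀ hsp, one_div, ← hnorm]
  have hsd : ‖-s * d‖ < 1 := by
    rwa [neg_mul, norm_neg, norm_mul, mul_comm, ← lt_div_iff₀ hsp, one_div, ← hnorm]
  have hsumc := summable_norm_qBinomCoeff (d := 1) (x := -s * c) 0 hq1 (by rwa [one_mul])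
  have hsumd := summable_norm_qBinomCoeff (d := 1) (x := -s * d) 0 hq1 (by rwa [one_mul])
  obtain ⟨w, hw_def⟩ : ∃ w : ℕ × ℕ → ℂ, ∀ p, w p = qBinomCoeff 1 0 (s ^ 2) p.1 * (-s * c) ^ p.1 *
    (qBinomCoeff 1 0 (s ^ 2) p.2 * (-s * d) ^ p.2) := ⟨_, fun _ ↦ rfl⟩
  have hw : Summable fun p ↦ ‖w p‖ := by
    have h := hsumc.mul_norm hsumd
    simpa only [hw_def] using h
  have hF := hasSum_integral_gaussian_mul_fourier hτ hw
  rw [← hs] at hF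
  have hpoint (x : ℝ) : Complex.exp ((π : ℂ) * Complex.I * τ * (x : ℂ) ^ 2) /
      (qPochInf (-s * c * Complex.exp (-(2 * (π : ℂ) * Complex.I * (x : ℂ)))) (s ^ 2) *
        qPochInf (-s * d * Complex.exp (2 * (π : ℂ) * Complex.I * (x : ℂ))) (s ^ 2)) =
      ∑' p, w p * Complex.exp (π * Complex.I * τ * x ^ 2 +
        2 * π * Complex.I * ((p.2 - p.1 : ℤ) : ℂ) * x + 0) := by
    set e := Complex.exp (2 * (π : ℂ) * Complex.I * (x : ℂ)) with he
    have he1 : ‖e‖ = 1 := by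
      rw [he, show 2 * (π : ℂ) * Complex.I * x = ((2 * π * x : ℝ) : ℂ) * Complex.I by
        push_cast; ring, Complex.norm_exp_ofReal_mul_I]
    have hc' : ‖-s * c * e⁻¹‖ < 1 := by rwa [norm_mul, norm_inv, he1, inv_one, mul_one]
    have hd' : ‖-s * d * e‖ < 1 := by rwa [norm_mul, he1, mul_one]
    rw [Complex.exp_neg, ← he, div_eq_mul_inv, mul_inv, inv_qPochInf_eq_tsum hq1 hc',
      inv_qPochInf_eq_tsum hq1 hd', tsum_mul_tsum_of_summable_norm
        (summable_norm_qBinomCoeff (d := 1) (x := -s * c * e⁻¹) 0 hq1 (by rwa [one_mul]))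
        (summable_norm_qBinomCoeff (d := 1) (x := -s * d * e) 0 hq1 (by rwa [one_mul])),
      ← tsum_mul_left]
    refine tsum_congr fun p ↦ ?_
    have hexp : Complex.exp (2 * π * Complex.I * ((p.2 - p.1 : ℤ) : ℂ) * x) =
        e ^ p.2 * e⁻¹ ^ p.1 := by
      rw [he, ← Complex.exp_neg, ← Complex.exp_nat_mul, ← Complex.exp_nat_mul, ← Complex.exp_add]
      push_cast
      ring_nf
    rw [hw_def, add_zero, Complex.exp_add, hexp, mul_pow _ e⁻¹, mul_pow _ e]
    ring
  have hconst : ((-Complex.I * τ) ^ (1 / 2 : ℂ))⁻¹ ≠ 0 := by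
    simp [Complex.cpow_eq_zero_iff, hτ0]
  have hsum2 : Summable fun p : ℕ × ℕ ↦ w p * s ^ ((p.2 - p.1 : ℤ) ^ 2) :=
    (summable_mul_left_iff hconst).mp hF.summable
  have hcd : ‖d * (s ^ 2 * c)‖ < 1 := by
    rw [show d * (s ^ 2 * c) = -s * c * (-s * d) by ring, norm_mul]
    exact mul_lt_one_of_nonneg_of_lt_one_left (norm_nonneg _) hsc hsd.le
  have hbinom := qPochInf_mul_tsum_qBinomCoeff 1 hq1 hcd
  rw [one_mul] at hbinom
  simp_rw [hpoint]
  rw [← hF.tsum_eq, tsum_mul_left, hsum2.tsum_prod]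
  simp_rw [hw_def, tsum_qBinomCoeff_mul_gaussian_right c d hq1 hs0]
  rw [tsum_mul_left, ← hbinom, show s ^ 2 * c * d = d * (s ^ 2 * c) by ring,
    mul_assoc (qPochInf (d * _) _), mul_comm (∑' _, _) (qPochInf _ _),
    mul_div_cancel_left₀ _ (qPochInf_ne_zero hq1 hcd)]
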